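/- Fix q > 0 and γ > 0. There exists a constant C = C(q,γ), independent of T, such that for every T ≥ 1 and every continuous f : [0,∞) → ℝ with ‖f‖_{q,T} < ∞, the function w(t) := −e^{−γt} ∫₀ᵗ e^{(2γ+7)s} (∫_s^∞ e^{−(γ+7)τ} f(τ) dτ) ds is well defined and twice continuously differentiable on [0,∞), satisfies w''(t) − 7w'(t) − γ(γ+7)·w(t) = f(t) for all t ≥ 0 together with w(0) = 0, and obeys the estimate ‖w‖_{q,T} ≤ C‖f‖_{q,T}. (This is the explicit solution formula with polynomially weighted estimate used in Steps 4 and 5 of the proof of Lemma 3.1 when the indicial root γ is positive.) -/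

import Mathlib

open Set MeasureTheory

noncomputable section

/-- The weighted tail integral `∫_s^∞ e^{-aτ} f(τ) dτ`. -/
def expTail (a : ℝ) (f : ℝ → ℝ) (s : ℝ) : ℝ :=
  ∫ τ in Ioi s, Real.exp (-a * τ) * f τ

/-- The solution formula attached to a positive indicial root `γ`. -/
def indicialSolution (γ : ℝ) (f : ℝ → ℝ) (t : ℝ) : ℝ :=
  -(Real.exp (-γ * t) * ∫ s in (0:ℝ)..t, Real.exp ((2 * γ + 7) * s) * expTail (γ + 7) f s)

theorem integrableOn_exp_neg_mul_mul {a N s : ℝ} {f : ℝ → ℝ} (ha : 0 < a)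
    (hf : ContinuousOn f (Ioi s)) (hN : ∀ τ ∈ Ioi s, |f τ| ≤ N) :
    IntegrableOn (fun τ => Real.exp (-a * τ) * f τ) (Ioi s) := by
  have h := integrableOn_exp_mul_Ioi (neg_lt_zero.mpr ha) s
  refine Integrable.mul_bdd h (hf.aestronglyMeasurable measurableSet_Ioi) (c := N) ?_
  exact (ae_restrict_iff' measurableSet_Ioi).2 (Filter.Eventually.of_forall hN)

theorem abs_expTail_le {a N s : ℝ} {f : ℝ → ℝ} (ha : 0 < a)
    (hN : ∀ τ ∈ Ioi s, |f τ| ≤ N) :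
    |expTail a f s| ≤ N * (Real.exp (-a * s) / a) := by
  have h := integrableOn_exp_mul_Ioi (neg_lt_zero.mpr ha) s
  have key := norm_integral_le_of_norm_le (f := fun τ => Real.exp (-a * τ) * f τ)
    (h.const_mul N) ((ae_restrict_iff' measurableSet_Ioi).2 (Filter.Eventually.of_forall
      fun τ hτ => by
        rw [Real.norm_eq_abs, abs_mul, Real.abs_exp, mul_comm]
        exact mul_le_mul_of_nonneg_right (hN τ hτ) (Real.exp_pos _).le))
  rwa [integral_const_mul, integral_exp_mul_Ioi (neg_lt_zero.mpr ha), neg_div_neg_eq] at key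

theorem hasDerivAt_expTail {a N : ℝ} {g : ℝ → ℝ} (ha : 0 < a) (hg : Continuous g)
    (hN : ∀ τ, |g τ| ≤ N) (t : ℝ) :
    HasDerivAt (expTail a g) (-(Real.exp (-a * t) * g t)) t := by
  have hint (s : ℝ) := integrableOn_exp_neg_mul_mul (s := s) ha hg.continuousOn fun τ _ => hN τ
  have hc : Continuous fun τ => Real.exp (-a * τ) * g τ := by fun_prop
  have heq : expTail a g = fun s => expTail a g 0 - ∫ τ in (0:ℝ)..s, Real.exp (-a * τ) * g τ := by
    funext s
    exact eq_sub_of_add_eq' (intervalIntegral.integral_interval_add_Ioi (hint 0) (hint s))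
  rw [heq]
  exact (hc.integral_hasStrictDerivAt 0 t).hasDerivAt.const_sub _

theorem hasDerivAt_exp_mul (c t : ℝ) :
    HasDerivAt (fun s => Real.exp (c * s)) (c * Real.exp (c * t)) t := by
  simpa [mul_comm] using ((hasDerivAt_id t).const_mul c).exp

theorem hasDerivAt_indicialSolution {γ N : ℝ} {g : ℝ → ℝ} (hγ : 0 < γ) (hg : Continuous g)
    (hN : ∀ τ, |g τ| ≤ N) (t : ℝ) :
    HasDerivAt (indicialSolution γ g)
      (-γ * indicialSolution γ g t - Real.exp ((γ + 7) * t) * expTail (γ + 7) g t) t := by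
  have hI : Continuous (expTail (γ + 7) g) := continuous_iff_continuousAt.2 fun s =>
    (hasDerivAt_expTail (by linarith) hg hN s).continuousAt
  have hH : Continuous fun s => Real.exp ((2 * γ + 7) * s) * expTail (γ + 7) g s := by fun_prop
  have key := ((hasDerivAt_exp_mul (-γ) t).mul (hH.integral_hasStrictDerivAt 0 t).hasDerivAt).neg
  have hexp : Real.exp ((γ + 7) * t) = Real.exp (-γ * t) * Real.exp ((2 * γ + 7) * t) := by
    rw [← Real.exp_add]; ring_nf
  refine key.congr_deriv ?_
  rw [indicialSolution, hexp]
  ring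

theorem hasDerivAt_deriv_indicialSolution {γ N : ℝ} {g : ℝ → ℝ} (hγ : 0 < γ) (hg : Continuous g)
    (hN : ∀ τ, |g τ| ≤ N) (t : ℝ) :
    HasDerivAt
      (fun s => -γ * indicialSolution γ g s - Real.exp ((γ + 7) * s) * expTail (γ + 7) g s)
      (-γ * (-γ * indicialSolution γ g t - Real.exp ((γ + 7) * t) * expTail (γ + 7) g t)
        - (γ + 7) * (Real.exp ((γ + 7) * t) * expTail (γ + 7) g t) + g t) t := by
  have key := ((hasDerivAt_indicialSolution hγ hg hN t).const_mul (-γ)).sub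
    ((hasDerivAt_exp_mul (γ + 7) t).mul (hasDerivAt_expTail (a := γ + 7) (by linarith) hg hN t))
  have hexp : Real.exp ((γ + 7) * t) * Real.exp (-(γ + 7) * t) = 1 := by
    rw [← Real.exp_add, Real.exp_eq_one_iff]; ring
  refine key.congr_deriv ?_
  linear_combination (g t) * hexp

theorem indicialSolution_congr {γ t : ℝ} {f g : ℝ → ℝ} (ht : 0 ≤ t) (h : EqOn f g (Ici 0)) :
    indicialSolution γ f t = indicialSolution γ g t := by
  unfold indicialSolution expTail
  congr 2
  refine intervalIntegral.integral_congr fun s hs => ?_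
  rw [uIcc_of_le ht] at hs
  refine congrArg _ (setIntegral_congr_fun measurableSet_Ioi fun τ hτ => ?_)
  exact congrArg _ (h (hs.1.trans (le_of_lt hτ)))

theorem one_add_rpow_le_exp {q γ x : ℝ} (hq : 0 < q) (hγ : 0 < γ) (hx : 0 ≤ x) :
    (1 + x) ^ q ≤ ((2 * q / γ) ^ q * Real.exp (γ / 2)) * Real.exp (γ / 2 * x) := by
  have h1 : 1 + x ≤ 2 * q / γ * Real.exp (γ / (2 * q) * (1 + x)) := by
    have h2 := Real.add_one_le_exp (γ / (2 * q) * (1 + x))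
    calc 1 + x = 2 * q / γ * (γ / (2 * q) * (1 + x)) := by field_simp
      _ ≤ _ := by gcongr; linarith
  calc (1 + x) ^ q ≤ (2 * q / γ * Real.exp (γ / (2 * q) * (1 + x))) ^ q := by gcongr
    _ = _ := by
      rw [Real.mul_rpow (by positivity) (by positivity), ← Real.exp_mul,
        mul_assoc ((2 * q / γ) ^ q),
        ← Real.exp_add]
      congr 2
      field_simp

theorem add_rpow_le_mul_exp {q γ T s t : ℝ} (hq : 0 < q) (hγ : 0 < γ) (hT : 1 ≤ T)
    (hs : 0 ≤ s) (hst : s ≤ t) :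
    (T + t) ^ q ≤ ((2 * q / γ) ^ q * Real.exp (γ / 2)) * Real.exp (γ / 2 * (t - s)) *
      (T + s) ^ q := by
  have hst' : 0 ≤ t - s := sub_nonneg.2 hst
  calc (T + t) ^ q ≤ ((1 + (t - s)) * (T + s)) ^ q := by
        gcongr
        · linarith
        · nlinarith
    _ = (1 + (t - s)) ^ q * (T + s) ^ q := Real.mul_rpow (by linarith) (by linarith)
    _ ≤ _ := by
        have := Real.rpow_nonneg (show 0 ≤ T + s by linarith) q
        gcongr
        exact one_add_rpow_le_exp hq hγ hst'

theorem rpow_mul_abs_indicialSolution_le {q γ T M t : ℝ} {f : ℝ → ℝ} (hq : 0 < q) (hγ : 0 < γ)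
    (hT : 1 ≤ T) (hM : ∀ t : ℝ, 0 ≤ t → (T + t) ^ q * |f t| ≤ M) (ht : 0 ≤ t) :
    (T + t) ^ q * |indicialSolution γ f t| ≤
      ((2 * q / γ) ^ q * Real.exp (γ / 2)) / (γ + 7) * (2 / γ) * M := by
  set K := (2 * q / γ) ^ q * Real.exp (γ / 2)
  have hK0 : 0 < K := by positivity
  have hpos (s : ℝ) (hs : 0 ≤ s) : 0 < (T + s) ^ q := Real.rpow_pos_of_pos (by linarith) q
  have hM0 : 0 ≤ M := (mul_nonneg (hpos 0 le_rfl).le (abs_nonneg _)).trans (hM 0 le_rfl)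
  have htail (s : ℝ) (hs : 0 ≤ s) :
      |expTail (γ + 7) f s| ≤ M / (T + s) ^ q * (Real.exp (-(γ + 7) * s) / (γ + 7)) := by
    refine abs_expTail_le (by linarith) fun τ hτ => ?_
    have hτ' : s ≤ τ := le_of_lt hτ
    rw [le_div_iff₀ (hpos s hs), mul_comm]
    refine le_trans ?_ (hM τ (hs.trans hτ'))
    gcongr
  have hinner (s : ℝ) (hs : s ∈ Ioc 0 t) :
      ‖Real.exp ((2 * γ + 7) * s) * expTail (γ + 7) f s‖ ≤
        M * K / (γ + 7) / (T + t) ^ q * Real.exp (γ / 2 * t) * Real.exp (γ / 2 * s) := by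
    have hw : M / (T + s) ^ q ≤ M * (K * Real.exp (γ / 2 * (t - s))) / (T + t) ^ q := by
      rw [div_le_div_iff₀ (hpos s hs.1.le) (hpos t ht), mul_assoc]
      exact mul_le_mul_of_nonneg_left (add_rpow_le_mul_exp hq hγ hT hs.1.le hs.2) hM0
    have he : Real.exp (γ / 2 * t) * Real.exp (γ / 2 * s) = Real.exp ((2 * γ + 7) * s) *
        (Real.exp (γ / 2 * (t - s)) * Real.exp (-(γ + 7) * s)) := by
      simp only [← Real.exp_add]; ring_nf
    rw [Real.norm_eq_abs, abs_mul, Real.abs_exp]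
    calc _ ≤ Real.exp ((2 * γ + 7) * s) * (M * (K * Real.exp (γ / 2 * (t - s))) / (T + t) ^ q *
          (Real.exp (-(γ + 7) * s) / (γ + 7))) := by
          refine mul_le_mul_of_nonneg_left ((htail s hs.1.le).trans ?_) (Real.exp_pos _).le
          gcongr
      _ = _ := by
          rw [mul_assoc _ (Real.exp (γ / 2 * t)), he]
          ring
  have hint := intervalIntegral.norm_integral_le_of_norm_le (μ := volume) ht
    (Filter.Eventually.of_forall hinner)
    (Continuous.intervalIntegrable (by fun_prop) 0 t)
  have hprim : ∫ s in (0:ℝ)..t, Real.exp (γ / 2 * s) ≤ 2 / γ * Real.exp (γ / 2 * t) := by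
    rw [intervalIntegral.integral_eq_sub_of_hasDerivAt
      (f := fun s => 2 / γ * Real.exp (γ / 2 * s))
      (fun s _ => ((hasDerivAt_exp_mul (γ / 2) s).const_mul (2 / γ)).congr_deriv (by field_simp))
      (Continuous.intervalIntegrable (by fun_prop) 0 t)]
    have : 0 < 2 / γ * Real.exp (γ / 2 * 0) := by positivity
    linarith
  rw [intervalIntegral.integral_const_mul] at hint
  have hp := hpos t ht
  have he : Real.exp (-γ * t) * (Real.exp (γ / 2 * t) * Real.exp (γ / 2 * t)) = 1 := by
    simp only [← Real.exp_add]; ring_nf; simp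
  rw [indicialSolution, abs_neg, abs_mul, Real.abs_exp]
  calc _ ≤ (T + t) ^ q * (Real.exp (-γ * t) * (M * K / (γ + 7) / (T + t) ^ q *
        Real.exp (γ / 2 * t) * (2 / γ * Real.exp (γ / 2 * t)))) := by
        gcongr
        exact hint.trans (by gcongr)
    _ = (Real.exp (-γ * t) * (Real.exp (γ / 2 * t) * Real.exp (γ / 2 * t))) *
        (K / (γ + 7) * (2 / γ) * M) := by field_simp
    _ = _ := by rw [he, one_mul]

/-- Fix q > 0 and γ > 0. There is C = C(q,γ), independent of T, such
that for every T ≥ 1 and continuous f on [0,∞) with ‖f‖_{q,T} ≤ M, the function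
w(t) = −e^{−γt}∫₀ᵗ e^{(2γ+7)s}(∫ₛ^∞ e^{−(γ+7)τ}f(τ)dτ)ds is well defined, twice
continuously differentiable on [0,∞), solves w'' − 7w' − γ(γ+7)w = f with w(0) = 0, and
satisfies ‖w‖_{q,T} ≤ C‖f‖_{q,T}. -/
theorem positive_indicial_root_ode (q γ : ℝ) (hq : 0 < q) (hγ : 0 < γ) :
    ∃ C : ℝ, ∀ T : ℝ, 1 ≤ T → ∀ f : ℝ → ℝ, ContinuousOn f (Ici 0) →
      ∀ M : ℝ, (∀ t : ℝ, 0 ≤ t → (T + t) ^ q * |f t| ≤ M) →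
      let w : ℝ → ℝ := fun t => -(Real.exp (-γ * t) *
        ∫ s in (0:ℝ)..t, Real.exp ((2 * γ + 7) * s) *
          ∫ τ in Ioi s, Real.exp (-(γ + 7) * τ) * f τ)
      (∀ s : ℝ, 0 ≤ s →
        IntegrableOn (fun τ => Real.exp (-(γ + 7) * τ) * f τ) (Ioi s)) ∧
      ∃ w' w'' : ℝ → ℝ,
        ContinuousOn w'' (Ici 0) ∧
        (∀ t ∈ Ici (0:ℝ), HasDerivWithinAt w (w' t) (Ici 0) t) ∧
        (∀ t ∈ Ici (0:ℝ), HasDerivWithinAt w' (w'' t) (Ici 0) t) ∧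
        (∀ t : ℝ, 0 ≤ t → w'' t - 7 * w' t - γ * (γ + 7) * w t = f t) ∧
        w 0 = 0 ∧
        (∀ t : ℝ, 0 ≤ t → (T + t) ^ q * |w t| ≤ C * M) := by
  refine ⟨((2 * q / γ) ^ q * Real.exp (γ / 2)) / (γ + 7) * (2 / γ), ?_⟩
  intro T hT f hf M hM w
  have hfM (t : ℝ) (ht : 0 ≤ t) : |f t| ≤ M :=
    (le_mul_of_one_le_left (abs_nonneg _)
      (Real.one_le_rpow (by linarith) hq.le)).trans (hM t ht)
  let g : ℝ → ℝ := fun t => f (max t 0)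
  have hg : Continuous g :=
    hf.comp_continuous (by fun_prop) fun t => le_max_right t 0
  have hgM (t : ℝ) : |g t| ≤ M := hfM _ (le_max_right t 0)
  have hfg : EqOn f g (Ici 0) := fun t ht => congrArg f (max_eq_left ht).symm
  have hw (t : ℝ) (ht : t ∈ Ici (0:ℝ)) : w t = indicialSolution γ g t :=
    indicialSolution_congr ht hfg
  have hd := hasDerivAt_indicialSolution hγ hg hgM
  have hI : Continuous (expTail (γ + 7) g) := continuous_iff_continuousAt.2 fun s =>
    (hasDerivAt_expTail (by linarith) hg hgM s).continuousAt
  have hS : Continuous (indicialSolution γ g) := continuous_iff_continuousAt.2 fun s =>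
    (hd s).continuousAt
  refine ⟨fun s hs => integrableOn_exp_neg_mul_mul (by linarith)
      (hf.mono fun τ hτ => hs.trans (le_of_lt hτ)) fun τ hτ => hfM τ (hs.trans (le_of_lt hτ)),
    _, _, ?_, fun t ht => (hd t).hasDerivWithinAt.congr hw (hw t ht),
    fun t _ => (hasDerivAt_deriv_indicialSolution hγ hg hgM t).hasDerivWithinAt,
    fun t ht => ?_, by simp [w],
    fun t ht => rpow_mul_abs_indicialSolution_le hq hγ hT hM ht⟩
  · exact Continuous.continuousOn (by fun_prop)
  · rw [hw t ht, hfg ht]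
    ring
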